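/- arXiv:math/0102059 — 8 statements merged into one kernel-verified Lean document; each statement's English description precedes it below -/
import Mathlib

section
/- Let A and B be finite sets and R ⊆ A × B. Suppose {A_i}_{i∈I} is a partition of A and {B_j}_{j∈J} is a partition of B which is equitable for R, and let R⁺ = ⋃{A_i × B_j : (A_i × B_j) ∩ R ≠ ∅}. If the bipartite graph ⟨A, B, R⁺⟩ has a complete matching, then so does ⟨A, B, R⟩. -/
open Finset in
/-- A fractional complete matching supported on `R` yields a complete matching. -/
theorem exists_injective_of_fractional_matching {A B : Type*} [Fintype A] [Fintype B]
    (R : A → B → Prop) (w : A → B → ℚ) (hw : ∀ a b, 0 ≤ w a b)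
    (hsupp : ∀ a b, ¬ R a b → w a b = 0) (hrow : ∀ a, ∑ b, w a b = 1)
    (hcol : ∀ b, ∑ a, w a b ≤ 1) :
    ∃ f : A → B, Function.Injective f ∧ ∀ a, R a (f a) := by
  classical
  obtain ⟨f, hf, hfR⟩ := (Finset.all_card_le_biUnion_card_iff_exists_injective
    (fun a => univ.filter (R a))).1 (by
      intro s
      have h : (#s : ℚ) ≤ #(s.biUnion fun a => univ.filter (R a)) := by
        calc (#s : ℚ) = ∑ a ∈ s, ∑ b, w a b := by simp [hrow]
          _ = ∑ a ∈ s, ∑ b ∈ s.biUnion (fun a => univ.filter (R a)), w a b := by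
            refine sum_congr rfl fun a ha => (sum_subset (subset_univ _) ?_).symm
            intro b _ hb
            refine hsupp a b fun hR => hb ?_
            simp only [mem_biUnion, mem_filter, mem_univ, true_and]
            exact ⟨a, ha, hR⟩
          _ = ∑ b ∈ s.biUnion (fun a => univ.filter (R a)), ∑ a ∈ s, w a b := sum_comm
          _ ≤ ∑ b ∈ s.biUnion (fun a => univ.filter (R a)), 1 := by
            refine sum_le_sum fun b _ => le_trans ?_ (hcol b)
            exact sum_le_sum_of_subset_of_nonneg (subset_univ _) fun a _ _ => hw a b
          _ = _ := by simp
      exact_mod_cast h)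
  exact ⟨f, hf, fun a => by simpa using hfR a⟩

open Finset in
/-- Double counting of the edges between two blocks of an equitable pair of partitions. -/
theorem card_block_mul_card_eq {A B I J : Type*} [Fintype A] [Fintype B]
    [DecidableEq I] [DecidableEq J] (R : A → B → Prop) [∀ a b, Decidable (R a b)]
    (pA : A → I) (pB : B → J)
    (hA : ∀ a a' : A, pA a = pA a' → ∀ j : J,
      #{b | pB b = j ∧ R a b} = #{b | pB b = j ∧ R a' b})
    (hB : ∀ b b' : B, pB b = pB b' → ∀ i : I,
      #{a | pA a = i ∧ R a b} = #{a | pA a = i ∧ R a b'}) (a : A) (b : B) :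
    #{a' | pA a' = pA a} * #{b' | pB b' = pB b ∧ R a b'} =
      #{b' | pB b' = pB b} * #{a' | pA a' = pA a ∧ R a' b} := by
  have h := sum_card_bipartiteAbove_eq_sum_card_bipartiteBelow R
    (s := {a' | pA a' = pA a}) (t := {b' | pB b' = pB b})
  simp only [bipartiteAbove, bipartiteBelow, filter_filter] at h
  rw [sum_congr rfl fun a' ha' => hA a' a (mem_filter.1 ha').2 (pB b),
    sum_congr rfl fun b' hb' => hB b' b (mem_filter.1 hb').2 (pA a)] at h
  simpa using h


/-- If the partitions `pA`, `pB` are equitable for `R` and `R⁺` joins every element of a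
block `A_i` to every element of a block `B_j` as soon as some `R`-edge joins the blocks,
then a complete matching for `⟨A, B, R⁺⟩` yields a complete matching for `⟨A, B, R⟩`. -/
theorem stmt0 {A B I J : Type} [Fintype A] [Fintype B]
    (R : A → B → Prop) (pA : A → I) (pB : B → J)
    (heqA : ∀ a a' : A, pA a = pA a' → ∀ j : J,
      Nat.card {b : B // pB b = j ∧ R a b} = Nat.card {b : B // pB b = j ∧ R a' b})
    (heqB : ∀ b b' : B, pB b = pB b' → ∀ i : I,
      Nat.card {a : A // pA a = i ∧ R a b} = Nat.card {a : A // pA a = i ∧ R a b'})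
    (Rplus : A → B → Prop)
    (hRplus : ∀ a b, Rplus a b ↔ ∃ a' b', pA a' = pA a ∧ pB b' = pB b ∧ R a' b')
    (M : A → B) (hMinj : Function.Injective M) (hMR : ∀ a, Rplus a (M a)) :
    ∃ M' : A → B, Function.Injective M' ∧ ∀ a, R a (M' a) := by
  classical
  simp only [Nat.card_eq_fintype_card, Fintype.card_subtype] at heqA heqB
  have hcount := card_block_mul_card_eq R pA pB heqA heqB
  have hApos (a : A) : 0 < Finset.card {a' | pA a' = pA a} :=
    Finset.card_pos.2 ⟨a, by simp⟩
  have hBpos (b : B) : 0 < Finset.card {b' | pB b' = pB b} :=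
    Finset.card_pos.2 ⟨b, by simp⟩
  have hdpos (a : A) : 0 < Finset.card {b | pB b = pB (M a) ∧ R a b} := by
    obtain ⟨a', b', ha, hb, hR⟩ := (hRplus _ _).1 (hMR a)
    rw [heqA a a' ha.symm]
    exact Finset.card_pos.2 ⟨b', by simp [hb, hR]⟩
  let e (a : A) : ℚ := (Finset.card {a' | pA a' = pA a} : ℚ) *
    Finset.card {b | pB b = pB (M a) ∧ R a b}
  have hepos (a : A) : 0 < e a :=
    mul_pos (by exact_mod_cast hApos a) (by exact_mod_cast hdpos a)
  refine exists_injective_of_fractional_matching R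
    (fun a b => ∑ a', if pA a' = pA a ∧ pB b = pB (M a') ∧ R a b then (e a')⁻¹ else 0)
    ?_ ?_ ?_ ?_
  · intro a b
    refine Finset.sum_nonneg fun a' _ => ?_
    split_ifs
    · exact (inv_pos.2 (hepos a')).le
    · exact le_rfl
  · intro a b hR
    simp [hR]
  · intro a
    rw [Finset.sum_comm]
    have key (a' : A) : (∑ b, if pA a' = pA a ∧ pB b = pB (M a') ∧ R a b then (e a')⁻¹ else 0) =
        if pA a' = pA a then (Finset.card {a' | pA a' = pA a} : ℚ)⁻¹ else 0 := by
      by_cases h : pA a' = pA a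
      · simp only [h, true_and, if_true]
        rw [← Finset.sum_filter, Finset.sum_const, nsmul_eq_mul, ← heqA a' a h]
        have hd : (Finset.card {b | pB b = pB (M a') ∧ R a' b} : ℚ) ≠ 0 := by
          exact_mod_cast (hdpos a').ne'
        simp only [e, h]
        rw [mul_inv, mul_left_comm, mul_inv_cancel₀ hd, mul_one]
      · simp [h]
    rw [Finset.sum_congr rfl fun a' _ => key a', ← Finset.sum_filter, Finset.sum_const,
      nsmul_eq_mul]
    exact mul_inv_cancel₀ (by exact_mod_cast (hApos a).ne')
  · intro b
    rw [Finset.sum_comm]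
    have key (a' : A) : (∑ a, if pA a' = pA a ∧ pB b = pB (M a') ∧ R a b then (e a')⁻¹ else 0) =
        if pB (M a') = pB b then (Finset.card {b' | pB b' = pB b} : ℚ)⁻¹ else 0 := by
      by_cases h : pB (M a') = pB b
      · simp only [h, true_and, if_true, eq_comm (a := pA a')]
        rw [← Finset.sum_filter, Finset.sum_const, nsmul_eq_mul]
        have he : e a' = (Finset.card {b' | pB b' = pB b} : ℚ) *
            Finset.card {a | pA a = pA a' ∧ R a b} := by
          simp only [e, h]
          exact_mod_cast hcount a' b
        have hc : (Finset.card {a | pA a = pA a' ∧ R a b} : ℚ) ≠ 0 :=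
          right_ne_zero_of_mul (he ▸ (hepos a').ne')
        rw [he, mul_inv, mul_left_comm, mul_inv_cancel₀ hc, mul_one]
      · simp [h, Ne.symm h]
    rw [Finset.sum_congr rfl fun a' _ => key a', ← Finset.sum_filter, Finset.sum_const,
      nsmul_eq_mul]
    have hle : Finset.card {a' | pB (M a') = pB b} ≤ Finset.card {b' | pB b' = pB b} :=
      Finset.card_le_card_of_injOn M (fun a' ha' => by simpa using ha') hMinj.injOn
    rw [← div_eq_mul_inv]
    exact div_le_one_of_le₀ (by exact_mod_cast hle) (Nat.cast_nonneg _)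
end

section
/- Let A and B be finite sets and R ⊆ A × B. Suppose {A_i}_{i∈I} is a partition of A and {B_j}_{j∈J} is a partition of B which is equitable for R, let R⁺ = ⋃{A_i × B_j : (A_i × B_j) ∩ R ≠ ∅}, and suppose the bipartite graph ⟨A, B, R⁺⟩ has a complete matching. Then for every subset X ⊆ A, the set Y = {b ∈ B : (∃ x ∈ X)(x,b) ∈ R} of R-neighbors of X satisfies |X| ≤ |Y|. -/
open Classical in
/-- If every vertex of the block `{a | p a = p a₀}` has as many neighbors in `S` as `a₀`, the number
of edges between that block and `S` is the product of the block size and the degree of `a₀`. -/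
theorem sum_edges_eq_block_mul_degree {A B I : Type} [Fintype A] [Fintype B] (R : A → B → Prop)
    (p : A → I) (S : B → Prop) (a₀ : A)
    (h : ∀ a, p a = p a₀ → Nat.card {b : B // S b ∧ R a b} = Nat.card {b : B // S b ∧ R a₀ b}) :
    (∑ a, ∑ b, if p a = p a₀ ∧ S b ∧ R a b then (1 : ℚ) else 0) =
      (∑ a, if p a = p a₀ then (1 : ℚ) else 0) * ∑ b, if S b ∧ R a₀ b then (1 : ℚ) else 0 := by
  rw [Finset.sum_mul]
  refine Finset.sum_congr rfl fun a _ => ?_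
  by_cases ha : p a = p a₀
  · have := h a ha
    simp only [Nat.card_eq_fintype_card, Fintype.card_subtype] at this
    simp [ha, this]
  · simp [ha]

theorem sum_ite_inv_mul_sum_ite {B : Type} [Fintype B] (P : B → Prop) [DecidablePred P] (k : ℚ)
    (hP : (∑ b, if P b then (1 : ℚ) else 0) ≠ 0) :
    (∑ b, if P b then (k * ∑ b', if P b' then (1 : ℚ) else 0)⁻¹ else 0) = k⁻¹ := by
  generalize hd : (∑ b, if P b then (1 : ℚ) else 0) = d at hP ⊢
  calc _ = (∑ b, if P b then (1 : ℚ) else 0) * (k * d)⁻¹ := by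
          simp only [Finset.sum_mul, ite_mul, one_mul, zero_mul]
    _ = k⁻¹ := by rw [hd, mul_inv, mul_left_comm, mul_inv_cancel₀ hP, mul_one]

open Classical in
/-- A nonnegative weight supported on `R` with row sums `1` and column sums at most `1`
(a fractional complete matching) forces the Hall condition. -/
theorem card_le_card_neighbors_of_fractional_matching {A B : Type} [Fintype A] [Fintype B]
    (R : A → B → Prop) (w : A → B → ℚ) (hw : ∀ a b, 0 ≤ w a b) (hR : ∀ a b, ¬ R a b → w a b = 0)
    (hrow : ∀ a, ∑ b, w a b = 1) (hcol : ∀ b, ∑ a, w a b ≤ 1) (X : Set A) :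
    Nat.card X ≤ Nat.card {b : B | ∃ x ∈ X, R x b} := by
  have key : (X.toFinset.card : ℚ) ≤ ({b : B | ∃ x ∈ X, R x b}.toFinset.card : ℚ) := by
    calc (X.toFinset.card : ℚ) = ∑ a ∈ X.toFinset, ∑ b, w a b := by simp [hrow]
      _ = ∑ a ∈ X.toFinset, ∑ b ∈ {b : B | ∃ x ∈ X, R x b}.toFinset, w a b := by
          refine Finset.sum_congr rfl fun a ha => (Finset.sum_subset (Finset.subset_univ _) ?_).symm
          intro b _ hb
          refine hR a b fun hab => hb ?_
          simp only [Set.mem_toFinset, Set.mem_ofPred_eq] at ha ⊢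
          exact ⟨a, ha, hab⟩
      _ = ∑ b ∈ {b : B | ∃ x ∈ X, R x b}.toFinset, ∑ a ∈ X.toFinset, w a b := Finset.sum_comm
      _ ≤ ∑ b ∈ {b : B | ∃ x ∈ X, R x b}.toFinset, 1 :=
          Finset.sum_le_sum fun b _ => (Finset.sum_le_sum_of_subset_of_nonneg
            (Finset.subset_univ _) fun a _ _ => hw a b).trans (hcol b)
      _ = _ := by simp
  rw [Nat.card_eq_card_toFinset, Nat.card_eq_card_toFinset]
  exact_mod_cast key

/-- With equitable partitions `pA`, `pB` for `R` and `R⁺` joining blocks completely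
whenever they contain an `R`-edge, if `⟨A, B, R⁺⟩` has a complete matching then `R`
satisfies the Hall condition: every `X ⊆ A` has at least `|X|` many `R`-neighbors. -/
theorem stmt2 {A B I J : Type} [Fintype A] [Fintype B]
    (R : A → B → Prop) (pA : A → I) (pB : B → J)
    (heqA : ∀ a a' : A, pA a = pA a' → ∀ j : J,
      Nat.card {b : B // pB b = j ∧ R a b} = Nat.card {b : B // pB b = j ∧ R a' b})
    (heqB : ∀ b b' : B, pB b = pB b' → ∀ i : I,
      Nat.card {a : A // pA a = i ∧ R a b} = Nat.card {a : A // pA a = i ∧ R a b'})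
    (Rplus : A → B → Prop)
    (hRplus : ∀ a b, Rplus a b ↔ ∃ a' b', pA a' = pA a ∧ pB b' = pB b ∧ R a' b')
    (M : A → B) (hMinj : Function.Injective M) (hMR : ∀ a, Rplus a (M a)) :
    ∀ X : Set A, Nat.card X ≤ Nat.card {b : B | ∃ x ∈ X, R x b} := by
  classical
  let N : I → J → ℚ := fun i j => ∑ a, ∑ b, if pA a = i ∧ pB b = j ∧ R a b then (1 : ℚ) else 0
  have hNnonneg : ∀ i j, 0 ≤ N i j := fun i j =>
    Finset.sum_nonneg fun a _ => Finset.sum_nonneg fun b _ => by split_ifs <;> norm_num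
  have hNpos : ∀ c, N (pA c) (pB (M c)) ≠ 0 := by
    intro c hc
    obtain ⟨a, b, ha, hb, hab⟩ := (hRplus c (M c)).1 (hMR c)
    have h1 := (Finset.sum_eq_zero_iff_of_nonneg fun a _ => Finset.sum_nonneg fun b _ => by
      split_ifs <;> norm_num).1 hc a (Finset.mem_univ a)
    have h2 := (Finset.sum_eq_zero_iff_of_nonneg fun b _ => by
      split_ifs <;> norm_num).1 h1 b (Finset.mem_univ b)
    simp [ha, hb, hab] at h2
  have hNA : ∀ a j, N (pA a) j = (∑ a', if pA a' = pA a then (1 : ℚ) else 0) *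
      ∑ b, if pB b = j ∧ R a b then (1 : ℚ) else 0 := fun a j =>
    sum_edges_eq_block_mul_degree R pA (fun b => pB b = j) a fun a' h => heqA a' a h j
  have hNB : ∀ b i, N i (pB b) = (∑ b', if pB b' = pB b then (1 : ℚ) else 0) *
      ∑ a, if pA a = i ∧ R a b then (1 : ℚ) else 0 := by
    intro b i
    rw [← sum_edges_eq_block_mul_degree (fun b a => R a b) pB (fun a => pA a = i) b
      fun b' h => heqB b' b h i, Finset.sum_comm]
    refine Finset.sum_congr rfl fun a _ => Finset.sum_congr rfl fun b' _ => ?_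
    exact if_congr and_left_comm rfl rfl
  let w : A → B → ℚ := fun a b => ∑ c,
    if pA a = pA c ∧ pB b = pB (M c) ∧ R a b then (N (pA c) (pB (M c)))⁻¹ else 0
  refine card_le_card_neighbors_of_fractional_matching R w ?_ ?_ ?_ ?_
  · intro a b
    refine Finset.sum_nonneg fun c _ => ?_
    split_ifs
    · exact inv_nonneg.2 (hNnonneg _ _)
    · exact le_rfl
  · intro a b hab
    simp [w, hab]
  · intro a
    have hk : (∑ a', if pA a' = pA a then (1 : ℚ) else 0) ≠ 0 := by
      intro h0
      have := (Finset.sum_eq_zero_iff_of_nonneg fun a _ => by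
        split_ifs <;> norm_num).1 h0 a (Finset.mem_univ a)
      simp at this
    rw [Finset.sum_comm, ← mul_inv_cancel₀ hk, Finset.sum_mul]
    refine Finset.sum_congr rfl fun c _ => ?_
    by_cases hc : pA c = pA a
    · have hN := hNpos c
      rw [hc, hNA] at hN
      simp only [hc, true_and, if_true, one_mul]
      rw [hNA]
      exact sum_ite_inv_mul_sum_ite _ _ (right_ne_zero_of_mul hN)
    · simp [hc, Ne.symm hc]
  · intro b
    have hk : 0 < ∑ b', if pB b' = pB b then (1 : ℚ) else 0 := by
      refine Finset.sum_pos' (fun _ _ => by split_ifs <;> norm_num) ⟨b, Finset.mem_univ b, by simp⟩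
    have hcount : (∑ c, if pB (M c) = pB b then (1 : ℚ) else 0) ≤
        ∑ b', if pB b' = pB b then (1 : ℚ) else 0 := by
      rw [← Finset.sum_image (s := Finset.univ) (g := M)
        (f := fun b' => if pB b' = pB b then (1 : ℚ) else 0) hMinj.injOn]
      exact Finset.sum_le_sum_of_subset_of_nonneg (Finset.subset_univ _)
        fun _ _ _ => by split_ifs <;> norm_num
    rw [Finset.sum_comm]
    refine le_trans (le_of_eq ?_) ((div_le_one hk).2 hcount)
    rw [div_eq_mul_inv, Finset.sum_mul]
    refine Finset.sum_congr rfl fun c _ => ?_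
    by_cases hc : pB (M c) = pB b
    · have hN := hNpos c
      rw [hc, hNB] at hN
      simp only [hc, true_and, if_true, one_mul]
      rw [hNB]
      exact sum_ite_inv_mul_sum_ite _ _ (right_ne_zero_of_mul hN)
    · simp [hc, Ne.symm hc]
end

section
/- Let G be a finite simple graph with vertex set V and edge set E, equipped with a linear order ≤ on V, and let 𝔊* be the associated Cai–Fürer–Immerman structure. Then the map S ↦ α_S is a group isomorphism from the group of all subsets of E under symmetric difference onto the automorphism group of 𝔊*; in particular, every automorphism of 𝔊* equals α_S for a unique S ⊆ E. -/
/-- The set of edges of `G` incident with the vertex `v`. -/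
def Inc {V : Type} (G : SimpleGraph V) (v : V) : Set (Sym2 V) :=
  {e | e ∈ G.edgeSet ∧ v ∈ e}

/-- The vertex set of the Cai–Fürer–Immerman structure `𝔊*`: pairs `(v, X)` with
`X ⊆ E_v`, together with pairs `(e, ε)` with `e` an edge and `ε ∈ {+, −}`
(`true` codes `+`, `false` codes `−`). -/
def CFIVert {V : Type} (G : SimpleGraph V) : Type :=
  {p : V × Set (Sym2 V) // p.2 ⊆ Inc G p.1} ⊕ ({e : Sym2 V // e ∈ G.edgeSet} × Bool)

/-- Adjacency in `𝔊*`: `(v, X)` is adjacent to `(e, +)` iff `v ∈ e` and `e ∈ X`,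
and to `(e, −)` iff `v ∈ e` and `e ∉ X`; no other adjacencies. -/
def CFIAdj {V : Type} (G : SimpleGraph V) : CFIVert G → CFIVert G → Prop
  | Sum.inl p, Sum.inr q => p.1.1 ∈ q.1.1 ∧ (q.1.1 ∈ p.1.2 ↔ q.2 = true)
  | Sum.inr q, Sum.inl p => p.1.1 ∈ q.1.1 ∧ (q.1.1 ∈ p.1.2 ↔ q.2 = true)
  | _, _ => False

/-- The relation `⪯` of `𝔊*`: it holds between `(v, X)` and `(v', X')` iff `v ≤ v'`,
and between no other pairs of vertices. -/
def CFIPre {V : Type} [LE V] (G : SimpleGraph V) : CFIVert G → CFIVert G → Prop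
  | Sum.inl p, Sum.inl p' => p.1.1 ≤ p'.1.1
  | _, _ => False

open Classical in
/-- The map `α_S`: it sends `(e, ε)` to `(e, −ε)` if `e ∈ S` and fixes it otherwise,
and sends `(v, X)` to `(v, X △ (S ∩ E_v))`. -/
noncomputable def CFIalpha {V : Type} (G : SimpleGraph V) (S : Set (Sym2 V)) :
    CFIVert G → CFIVert G :=
  fun x => match x with
  | Sum.inl p => Sum.inl ⟨(p.1.1, symmDiff p.1.2 (S ∩ Inc G p.1.1)), by
      intro e he
      rcases Set.mem_symmDiff.mp he with ⟨h1, _⟩ | ⟨h1, _⟩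
      · exact p.2 h1
      · exact h1.2⟩
  | Sum.inr q => Sum.inr (q.1, if q.1.1 ∈ S then !q.2 else q.2)

/-- An automorphism of `𝔊*`: a bijection of its vertex set preserving adjacency and
the relation `⪯` in both directions. -/
def CFIIsAut {V : Type} [LE V] (G : SimpleGraph V) (π : CFIVert G → CFIVert G) : Prop :=
  Function.Bijective π ∧
  (∀ x y, CFIAdj G x y ↔ CFIAdj G (π x) (π y)) ∧
  (∀ x y, CFIPre G x y ↔ CFIPre G (π x) (π y))

theorem CFIalpha_symmDiff {V : Type} (G : SimpleGraph V) (S S' : Set (Sym2 V)) :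
    CFIalpha G (symmDiff S S') = CFIalpha G S ∘ CFIalpha G S' := by
  funext x
  rcases x with ⟨⟨v, X⟩, hX⟩ | ⟨⟨e, he⟩, b⟩
  · refine congrArg Sum.inl (Subtype.ext (Prod.ext rfl ?_))
    ext e
    simp only [Set.mem_symmDiff, Set.mem_inter_iff]
    tauto
  · refine congrArg Sum.inr (Prod.ext rfl ?_)
    by_cases h : e ∈ S <;> by_cases h' : e ∈ S' <;> simp [Set.mem_symmDiff, h, h']

theorem CFIalpha_empty {V : Type} (G : SimpleGraph V) : CFIalpha G ∅ = id := by
  funext x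
  rcases x with ⟨⟨v, X⟩, hX⟩ | ⟨⟨e, he⟩, b⟩
  · refine congrArg Sum.inl (Subtype.ext (Prod.ext rfl ?_))
    ext e
    simp [Set.mem_symmDiff]
  · refine congrArg Sum.inr (Prod.ext rfl ?_)
    simp

theorem CFIalpha_involutive {V : Type} (G : SimpleGraph V) (S : Set (Sym2 V)) :
    Function.Involutive (CFIalpha G S) := fun x => by
  have h := CFIalpha_symmDiff G S S
  rw [symmDiff_self, Set.bot_eq_empty, CFIalpha_empty] at h
  exact (congrFun h x).symm

theorem CFIAdj_comm {V : Type} (G : SimpleGraph V) (x y : CFIVert G) :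
    CFIAdj G x y ↔ CFIAdj G y x := by
  rcases x with p | q <;> rcases y with p' | q' <;> exact Iff.rfl

theorem CFIAdj_CFIalpha_inl_inr {V : Type} (G : SimpleGraph V) (S : Set (Sym2 V))
    (p : {p : V × Set (Sym2 V) // p.2 ⊆ Inc G p.1}) (q : {e : Sym2 V // e ∈ G.edgeSet} × Bool) :
    CFIAdj G (Sum.inl p) (Sum.inr q) ↔
      CFIAdj G (CFIalpha G S (Sum.inl p)) (CFIalpha G S (Sum.inr q)) := by
  obtain ⟨⟨v, X⟩, hX⟩ := p
  obtain ⟨⟨e, he⟩, b⟩ := q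
  refine and_congr_right fun (hv : v ∈ e) => ?_
  have hi : e ∈ Inc G v := ⟨he, hv⟩
  by_cases hS : e ∈ S <;> by_cases hx : e ∈ X <;> cases b <;>
    simp [Set.mem_symmDiff, hS, hx, hi]

theorem CFIIsAut_CFIalpha {V : Type} [LE V] (G : SimpleGraph V) (S : Set (Sym2 V)) :
    CFIIsAut G (CFIalpha G S) := by
  refine ⟨(CFIalpha_involutive G S).bijective, ?_, ?_⟩
  · rintro (p | q) (p' | q')
    · exact Iff.rfl
    · exact CFIAdj_CFIalpha_inl_inr G S p q'
    · exact (CFIAdj_comm G _ _).trans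
        ((CFIAdj_CFIalpha_inl_inr G S p' q).trans (CFIAdj_comm G _ _))
    · exact Iff.rfl
  · rintro (p | q) (p' | q') <;> exact Iff.rfl

theorem CFIalpha_injOn {V : Type} (G : SimpleGraph V) :
    Set.InjOn (CFIalpha G) {S | S ⊆ G.edgeSet} := by
  intro S hS S' hS' h
  ext e
  by_cases he : e ∈ G.edgeSet
  · have h1 := congrFun h (Sum.inr (⟨e, he⟩, true))
    have h2 := congrArg Prod.snd (Sum.inr.inj h1)
    by_cases h3 : e ∈ S <;> by_cases h4 : e ∈ S' <;> simp [h3, h4] at h2 ⊢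
  · exact ⟨fun h' => absurd (hS h') he, fun h' => absurd (hS' h') he⟩

theorem strictMono_eq_self_of_finite {V : Type*} [Finite V] [LinearOrder V] {f : V → V}
    (hf : StrictMono f) (v : V) : f v = v :=
  le_antisymm (hf.dual.le_apply (x := OrderDual.toDual v)) hf.le_apply

/-- An automorphism fixes the first coordinate of every vertex `(v, X)`. -/
theorem CFIIsAut.exists_map_inl {V : Type} [Finite V] [LinearOrder V] {G : SimpleGraph V}
    {π : CFIVert G → CFIVert G} (hπ : CFIIsAut G π)
    (p : {p : V × Set (Sym2 V) // p.2 ⊆ Inc G p.1}) :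
    ∃ p' : {p : V × Set (Sym2 V) // p.2 ⊆ Inc G p.1},
      p'.1.1 = p.1.1 ∧ π (Sum.inl p) = Sum.inl p' := by
  have key : ∀ p : {p : V × Set (Sym2 V) // p.2 ⊆ Inc G p.1},
      ∃ p' : {p : V × Set (Sym2 V) // p.2 ⊆ Inc G p.1}, π (Sum.inl p) = Sum.inl p' := by
    intro p
    have h := (hπ.2.2 (Sum.inl p) (Sum.inl p)).1 (le_refl p.1.1)
    rcases hx : π (Sum.inl p) with p' | q
    · exact ⟨p', rfl⟩
    · rw [hx] at h
      exact h.elim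
  choose g hg using key
  have hle : ∀ p p', p.1.1 ≤ p'.1.1 ↔ (g p).1.1 ≤ (g p').1.1 := by
    intro p p'
    have h := hπ.2.2 (Sum.inl p) (Sum.inl p')
    rw [hg, hg] at h
    exact h
  let o : V → {p : V × Set (Sym2 V) // p.2 ⊆ Inc G p.1} := fun v => ⟨(v, ∅), Set.empty_subset _⟩
  have hmono : StrictMono fun v => (g (o v)).1.1 := fun v w hvw =>
    lt_of_not_ge fun h => not_le_of_gt hvw ((hle (o w) (o v)).2 h)
  refine ⟨g p, ?_, hg p⟩
  rw [← strictMono_eq_self_of_finite hmono p.1.1]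
  exact le_antisymm ((hle p (o p.1.1)).1 le_rfl) ((hle (o p.1.1) p).1 le_rfl)

/-- An automorphism fixes the first coordinate of every vertex `(e, ε)`. -/
theorem CFIIsAut.exists_map_inr {V : Type} [Finite V] [LinearOrder V] {G : SimpleGraph V}
    {π : CFIVert G → CFIVert G} (hπ : CFIIsAut G π) (e : {e : Sym2 V // e ∈ G.edgeSet})
    (b : Bool) : ∃ b', π (Sum.inr (e, b)) = Sum.inr (e, b') := by
  rcases hx : π (Sum.inr (e, b)) with p | ⟨e', b'⟩
  · have h := (hπ.2.2 (Sum.inr (e, b)) (Sum.inr (e, b))).2 (by rw [hx]; exact le_refl p.1.1)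
    exact h.elim
  · refine ⟨b', ?_⟩
    have hmem : ∀ v ∈ e.1, v ∈ e'.1 := by
      intro v hv
      let p : {p : V × Set (Sym2 V) // p.2 ⊆ Inc G p.1} :=
        ⟨(v, {f | f = e.1 ∧ b = true}), by rintro f ⟨rfl, -⟩; exact ⟨e.2, hv⟩⟩
      have hadj : CFIAdj G (Sum.inl p) (Sum.inr (e, b)) := ⟨hv, by simp [p]⟩
      obtain ⟨p', hp', hπp⟩ := hπ.exists_map_inl p
      have hadj' := (hπ.2.1 _ _).1 hadj
      rw [hx, hπp] at hadj'
      exact (congrArg (· ∈ e'.1) hp').mp hadj'.1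
    have hee : e' = e := by
      obtain ⟨e, he⟩ := e
      refine Subtype.ext ?_
      induction e using Sym2.ind with
      | _ u v =>
        have huv : u ≠ v := G.ne_of_adj he
        exact (Sym2.mem_and_mem_iff huv).1
          ⟨hmem u (Sym2.mem_mk_left u v), hmem v (Sym2.mem_mk_right u v)⟩
    rw [hee]

theorem CFIIsAut.exists_eq_CFIalpha {V : Type} [Finite V] [LinearOrder V] {G : SimpleGraph V}
    {π : CFIVert G → CFIVert G} (hπ : CFIIsAut G π) :
    ∃ S ⊆ G.edgeSet, π = CFIalpha G S := by
  choose c hc using hπ.exists_map_inr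
  have hne : ∀ e, c e false = !c e true := by
    intro e
    refine Bool.eq_not.2 fun h => ?_
    have h1 : π (Sum.inr (e, false)) = π (Sum.inr (e, true)) := by rw [hc, hc, h]
    have h2 := congrArg Prod.snd (Sum.inr.inj (hπ.1.1 h1))
    exact Bool.false_ne_true h2
  let S : Set (Sym2 V) := {e | ∃ h : e ∈ G.edgeSet, c ⟨e, h⟩ true = false}
  have hinr : ∀ q, π (Sum.inr q) = CFIalpha G S (Sum.inr q) := by
    rintro ⟨⟨e, he⟩, b⟩
    rw [hc]
    refine congrArg Sum.inr (Prod.ext rfl ?_)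
    have hS : e ∈ S ↔ c ⟨e, he⟩ true = false := ⟨fun h => h.2, fun h => ⟨he, h⟩⟩
    have h0 := hne ⟨e, he⟩
    cases h : c ⟨e, he⟩ true <;> cases b <;> simp_all
  refine ⟨S, fun e he => he.1, funext ?_⟩
  rintro (p | q)
  · obtain ⟨p', hp', hπp⟩ := hπ.exists_map_inl p
    rw [hπp]
    refine congrArg Sum.inl (Subtype.ext (Prod.ext hp' ?_))
    have hsub : (symmDiff p.1.2 (S ∩ Inc G p.1.1)) ⊆ Inc G p.1.1 := by
      rintro f (⟨h, -⟩ | ⟨h, -⟩)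
      exacts [p.2 h, h.2]
    have hsub' : p'.1.2 ⊆ Inc G p.1.1 := hp' ▸ p'.2
    have hmem : ∀ f ∈ Inc G p.1.1, f ∈ p'.1.2 ↔ f ∈ symmDiff p.1.2 (S ∩ Inc G p.1.1) := by
      intro f hf
      obtain ⟨b, hb⟩ : ∃ b, CFIalpha G S (Sum.inr (⟨f, hf.1⟩, b)) = Sum.inr (⟨f, hf.1⟩, true) :=
        by
        obtain ⟨b, hb⟩ := (CFIIsAut_CFIalpha G S).exists_map_inr ⟨f, hf.1⟩ true
        exact ⟨b, (congrArg _ hb).symm.trans (CFIalpha_involutive G S _)⟩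
      have h1 := hπ.2.1 (Sum.inl p) (Sum.inr (⟨f, hf.1⟩, b))
      rw [CFIAdj_CFIalpha_inl_inr G S, hinr, hb, hπp] at h1
      have h2 : (p.1.1 ∈ f ∧ (f ∈ symmDiff p.1.2 (S ∩ Inc G p.1.1) ↔ true = true)) ↔
          (p'.1.1 ∈ f ∧ (f ∈ p'.1.2 ↔ true = true)) := h1
      rw [hp'] at h2
      simpa [hf.2] using h2.symm
    exact Set.ext fun f => ⟨fun h => (hmem f (hsub' h)).1 h, fun h => (hmem f (hsub h)).2 h⟩
  · exact hinr q

/-- `S ↦ α_S` is a group isomorphism from the subsets of `E` under symmetric difference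
onto the automorphism group of `𝔊*`: each `α_S` is an automorphism, the map is a
homomorphism, and every automorphism equals `α_S` for a unique `S ⊆ E`. -/
theorem stmt5 {V : Type} [Fintype V] [LinearOrder V] (G : SimpleGraph V) :
    (∀ S : Set (Sym2 V), S ⊆ G.edgeSet → CFIIsAut G (CFIalpha G S)) ∧
    (∀ S S' : Set (Sym2 V), S ⊆ G.edgeSet → S' ⊆ G.edgeSet →
      CFIalpha G (symmDiff S S') = CFIalpha G S ∘ CFIalpha G S') ∧
    (∀ π : CFIVert G → CFIVert G, CFIIsAut G π →
      ∃! S : Set (Sym2 V), S ⊆ G.edgeSet ∧ π = CFIalpha G S) := by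
  refine ⟨fun S _ => CFIIsAut_CFIalpha G S, fun S S' _ _ => CFIalpha_symmDiff G S S', ?_⟩
  intro π hπ
  obtain ⟨S, hS, rfl⟩ := hπ.exists_eq_CFIalpha
  exact ⟨S, ⟨hS, rfl⟩, fun S' h => CFIalpha_injOn G h.1 hS h.2.symm⟩
end

section
/- Let G be a finite connected simple graph with vertex set V and edge set E, equipped with a linear order ≤ on V, and let T, T' ⊆ V. Then the structures 𝔊^T and 𝔊^{T'} are isomorphic if and only if |T| ≡ |T'| (mod 2). -/
/-- The vertex set of the induced substructure `𝔊^T` of `𝔊*`: all vertices `(e, ε)`,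
together with those `(v, X)` such that `|X|` is odd if `v ∈ T` and even if `v ∉ T`. -/
def CFISub {V : Type} (G : SimpleGraph V) (T : Set V) : Set (CFIVert G) :=
  fun x => match x with
  | Sum.inl p => p.1.1 ∈ T ↔ Odd (Nat.card p.1.2)
  | Sum.inr _ => True

/-- A bijection `φ : 𝔊^T → 𝔊^{T'}` is an isomorphism of the induced structures if it
preserves adjacency and the relation `⪯` in both directions. -/
def CFISubIso {V : Type} [LE V] (G : SimpleGraph V) (T T' : Set V)
    (φ : ↥(CFISub G T) ≃ ↥(CFISub G T')) : Prop :=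
  (∀ x y : ↥(CFISub G T), CFIAdj G x.1 y.1 ↔ CFIAdj G (φ x).1 (φ y).1) ∧
  (∀ x y : ↥(CFISub G T), CFIPre G x.1 y.1 ↔ CFIPre G (φ x).1 (φ y).1)

/-- The boundary (over `ZMod 2`) of any edge labelling has coordinate sum zero. -/
lemma sum_incMatrix_mulVec {V : Type} [Fintype V] [DecidableEq V] (G : SimpleGraph V)
    [DecidableRel G.Adj]
    (d : Sym2 V → ZMod 2) : ∑ v, (G.incMatrix (ZMod 2)).mulVec d v = 0 := by
  simp only [Matrix.mulVec, dotProduct]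
  rw [Finset.sum_comm]
  refine Finset.sum_eq_zero fun e _ => ?_
  rw [← Finset.sum_mul]
  by_cases he : e ∈ G.edgeSet
  · rw [SimpleGraph.sum_incMatrix_apply_of_mem_edgeSet _ he]
    have : (2 : ZMod 2) = 0 := rfl
    rw [this, zero_mul]
  · rw [SimpleGraph.sum_incMatrix_apply_of_notMem_edgeSet _ he, zero_mul]

lemma incMatrix_mulVec_single {V : Type} [Fintype V] [DecidableEq V] (G : SimpleGraph V)
    [DecidableRel G.Adj] {u v : V}
    (h : G.Adj u v) :
    (G.incMatrix (ZMod 2)).mulVec (Pi.single s(u, v) 1) = Pi.single u 1 + Pi.single v 1 := by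
  ext w
  have hne := h.ne
  simp only [Matrix.mulVec_single_one, Matrix.col_apply, SimpleGraph.incMatrix_apply',
    SimpleGraph.mk'_mem_incidenceSet_iff, h, true_and, Pi.add_apply, Pi.single_apply]
  by_cases h1 : w = u <;> by_cases h2 : w = v <;> simp_all

lemma single_add_single_mem_range {V : Type} [Fintype V] [DecidableEq V] (G : SimpleGraph V)
    [DecidableRel G.Adj] {u v : V}
    (p : G.Walk u v) : (Pi.single u 1 + Pi.single v 1 : V → ZMod 2) ∈
      LinearMap.range (G.incMatrix (ZMod 2)).mulVecLin := by
  induction p with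
  | nil => rw [← two_nsmul, ZModModule.char_nsmul_eq_zero]; exact zero_mem _
  | @cons a b c h p ih =>
    have key : (Pi.single a 1 + Pi.single c 1 : V → ZMod 2) =
        (Pi.single a 1 + Pi.single b 1) + (Pi.single b 1 + Pi.single c 1) := by
      rw [add_assoc, ← add_assoc (Pi.single b 1), ← two_nsmul,
        ZModModule.char_nsmul_eq_zero, zero_add]
    rw [key]
    exact add_mem ⟨_, incMatrix_mulVec_single G h⟩ ih

/-- In a connected graph, the boundaries over `ZMod 2` are the vertex labellings of sum zero. -/
lemma exists_incMatrix_mulVec_eq_iff {V : Type} [Fintype V] [DecidableEq V] (G : SimpleGraph V)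
    [DecidableRel G.Adj]
    (hG : G.Connected) (f : V → ZMod 2) :
    (∃ d, (G.incMatrix (ZMod 2)).mulVec d = f) ↔ ∑ v, f v = 0 := by
  constructor
  · rintro ⟨d, rfl⟩
    exact sum_incMatrix_mulVec G d
  · intro hf
    obtain ⟨r⟩ := hG.nonempty
    have key : f = ∑ v, f v • (Pi.single v 1 + Pi.single r 1 : V → ZMod 2) := by
      simp only [smul_add, Finset.sum_add_distrib, ← Finset.sum_smul, hf, zero_smul, add_zero]
      ext w
      simp [Finset.sum_apply, Pi.single_apply]
    have hmem : f ∈ LinearMap.range (G.incMatrix (ZMod 2)).mulVecLin := by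
      rw [key]
      refine sum_mem fun v _ => Submodule.smul_mem _ _ ?_
      obtain ⟨p⟩ := hG.preconnected v r
      exact single_add_single_mem_range G p
    exact hmem

lemma sum_indicator_one_eq_card {α : Type} [Fintype α] (S : Set α) :
    ∑ a, S.indicator (1 : α → ZMod 2) a = (Nat.card S : ZMod 2) := by
  classical
  simp [Set.indicator_apply, Finset.sum_boole, Nat.card_eq_fintype_card,
    Fintype.card_subtype]

lemma incMatrix_mulVec_indicator {V : Type} [Fintype V] [DecidableEq V] (G : SimpleGraph V)
    [DecidableRel G.Adj] {v : V}
    {X : Set (Sym2 V)} (hX : X ⊆ Inc G v) :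
    (G.incMatrix (ZMod 2)).mulVec (X.indicator 1) v = (Nat.card X : ZMod 2) := by
  rw [← sum_indicator_one_eq_card]
  refine Finset.sum_congr rfl fun e _ => ?_
  by_cases he : e ∈ X
  · have : e ∈ G.incidenceSet v := hX he
    simp [SimpleGraph.incMatrix_apply', this]
  · simp [he]

lemma mem_iff_odd_card_iff {V : Type} [Fintype V] [DecidableEq V] (G : SimpleGraph V)
    [DecidableRel G.Adj] {v : V}
    {X : Set (Sym2 V)} (hX : X ⊆ Inc G v) (T : Set V) :
    (v ∈ T ↔ Odd (Nat.card X)) ↔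
      (G.incMatrix (ZMod 2)).mulVec (X.indicator 1) v = T.indicator 1 v := by
  rw [incMatrix_mulVec_indicator G hX, ← ZMod.natCast_eq_one_iff_odd]
  generalize (Nat.card X : ZMod 2) = a
  by_cases hv : v ∈ T
  · simp [hv]
  · simp only [hv, false_iff, Set.indicator_of_notMem, not_false_eq_true]
    revert a
    decide

/-- Two vertices `(u, X)`, `(v, Y)` over an edge `uv` have a common neighbour iff `X` and `Y`
agree on `uv`. -/
lemma exists_common_neighbour_iff {V : Type} (G : SimpleGraph V) (T : Set V)
    (p q : {p : V × Set (Sym2 V) // p.2 ⊆ Inc G p.1}) (h : G.Adj p.1.1 q.1.1) :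
    (∃ y : ↥(CFISub G T), CFIAdj G (Sum.inl p) y.1 ∧ CFIAdj G (Sum.inl q) y.1) ↔
      (s(p.1.1, q.1.1) ∈ p.1.2 ↔ s(p.1.1, q.1.1) ∈ q.1.2) := by
  classical
  constructor
  · rintro ⟨⟨y | ⟨⟨e, he⟩, b⟩, hy⟩, h1, h2⟩
    · exact h1.elim
    · obtain ⟨h1, h1'⟩ := h1
      obtain ⟨h2, h2'⟩ := h2
      have : e = s(p.1.1, q.1.1) := (Sym2.mem_and_mem_iff h.ne).1 ⟨h1, h2⟩
      subst this
      exact h1'.trans h2'.symm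
  · intro hpq
    refine ⟨⟨Sum.inr (⟨s(p.1.1, q.1.1), h⟩, decide (s(p.1.1, q.1.1) ∈ p.1.2)), trivial⟩,
      ⟨Sym2.mem_mk_left _ _, ?_⟩, ⟨Sym2.mem_mk_right _ _, ?_⟩⟩
    · simp
    · simp [hpq]

/-- Flipping the edges in `D`. -/
def cfiFlip {V : Type} (G : SimpleGraph V) (D : Set (Sym2 V)) [DecidablePred (· ∈ D)] :
    CFIVert G → CFIVert G
  | Sum.inl p => Sum.inl ⟨(p.1.1, symmDiff p.1.2 (D ∩ Inc G p.1.1)), by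
      rintro e (⟨he, -⟩ | ⟨⟨-, he⟩, -⟩)
      exacts [p.2 he, he]⟩
  | Sum.inr q => Sum.inr (q.1, xor q.2 (decide (q.1.1 ∈ D)))

lemma cfiFlip_involutive {V : Type} (G : SimpleGraph V) (D : Set (Sym2 V))
    [DecidablePred (· ∈ D)] : Function.Involutive (cfiFlip G D) := by
  rintro (⟨⟨v, X⟩, hX⟩ | ⟨e, b⟩)
  · simp only [cfiFlip, symmDiff_symmDiff_cancel_right]
    rfl
  · simp only [cfiFlip, Bool.xor_assoc, Bool.xor_self, Bool.xor_false]
    rfl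

lemma cfiAdj_flip_iff {V : Type} (G : SimpleGraph V) (D : Set (Sym2 V))
    [DecidablePred (· ∈ D)] (x y : CFIVert G) :
    CFIAdj G (cfiFlip G D x) (cfiFlip G D y) ↔ CFIAdj G x y := by
  have key (p : {p : V × Set (Sym2 V) // p.2 ⊆ Inc G p.1})
      (q : {e : Sym2 V // e ∈ G.edgeSet} × Bool) :
      (p.1.1 ∈ q.1.1 ∧ (q.1.1 ∈ symmDiff p.1.2 (D ∩ Inc G p.1.1) ↔
        xor q.2 (decide (q.1.1 ∈ D)) = true)) ↔
      (p.1.1 ∈ q.1.1 ∧ (q.1.1 ∈ p.1.2 ↔ q.2 = true)) := by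
    refine and_congr_right fun h => ?_
    have hi : q.1.1 ∈ Inc G p.1.1 := ⟨q.1.2, h⟩
    by_cases h1 : q.1.1 ∈ D <;> by_cases h2 : q.1.1 ∈ p.1.2 <;> cases h3 : q.2 <;>
      simp [Set.mem_symmDiff, h1, h2, hi]
  rcases x with p | q <;> rcases y with p' | q'
  · rfl
  · exact key p q'
  · exact key p' q
  · rfl

lemma cfiPre_flip_iff {V : Type} [LE V] (G : SimpleGraph V) (D : Set (Sym2 V))
    [DecidablePred (· ∈ D)] (x y : CFIVert G) :
    CFIPre G (cfiFlip G D x) (cfiFlip G D y) ↔ CFIPre G x y := by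
  rcases x with p | q <;> rcases y with p' | q' <;> rfl

lemma cfiFlip_mem_iff {V : Type} [Fintype V] [DecidableEq V] (G : SimpleGraph V)
    [DecidableRel G.Adj] (T T' : Set V)
    {d : Sym2 V → ZMod 2}
    (hd : (G.incMatrix (ZMod 2)).mulVec d = T.indicator 1 + T'.indicator 1) (x : CFIVert G) :
    x ∈ CFISub G T ↔ cfiFlip G {e | d e ≠ 0} x ∈ CFISub G T' := by
  rcases x with p | q
  · refine (mem_iff_odd_card_iff G p.2 T).trans
      (Iff.trans ?_ (mem_iff_odd_card_iff G
        (X := symmDiff p.1.2 ({e | d e ≠ 0} ∩ Inc G p.1.1)) ?_ T').symm)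
    · have key : (G.incMatrix (ZMod 2)).mulVec
          ((symmDiff p.1.2 ({e | d e ≠ 0} ∩ Inc G p.1.1)).indicator 1) p.1.1 =
          (G.incMatrix (ZMod 2)).mulVec (p.1.2.indicator 1 + d) p.1.1 := by
        refine Finset.sum_congr rfl fun e _ => ?_
        by_cases he : e ∈ G.incidenceSet p.1.1
        · have he' : e ∈ Inc G p.1.1 := he
          congr 1
          have h01 : ∀ a : ZMod 2, a = 0 ∨ a = 1 := by decide
          by_cases h2 : e ∈ p.1.2 <;> rcases h01 (d e) with h | h <;>
            simp [Set.mem_symmDiff, h2, h, he']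
          decide
        · simp [SimpleGraph.incMatrix_apply', he]
      rw [key, Matrix.mulVec_add, hd]
      simp only [Pi.add_apply]
      generalize (G.incMatrix (ZMod 2)).mulVec (p.1.2.indicator 1) p.1.1 = a
      generalize T.indicator (1 : V → ZMod 2) p.1.1 = b
      generalize T'.indicator (1 : V → ZMod 2) p.1.1 = c
      revert a b c
      decide
    · rintro e (⟨he, -⟩ | ⟨⟨-, he⟩, -⟩)
      exacts [p.2 he, he]
  · exact Iff.rfl

lemma exists_subset_inc_parity {V : Type} (G : SimpleGraph V) {v w : V} (h : G.Adj v w)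
    (T : Set V) : ∃ X ⊆ Inc G v, (v ∈ T ↔ Odd (Nat.card X)) := by
  by_cases hv : v ∈ T
  · refine ⟨{s(v, w)}, ?_, by simp [hv]⟩
    rintro _ rfl
    exact ⟨h, Sym2.mem_mk_left _ _⟩
  · exact ⟨∅, Set.empty_subset _, by simp [hv]⟩

/-- An isomorphism maps vertices over `v` to vertices over `v`, when no fibre is empty. -/
lemma exists_apply_eq_of_cfiSubIso {V : Type} [Fintype V] [LinearOrder V] (G : SimpleGraph V)
    {T T' : Set V} {φ : ↥(CFISub G T) ≃ ↥(CFISub G T')} (hφ : CFISubIso G T T' φ)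
    (x : V → ↥(CFISub G T)) (p : V → {p : V × Set (Sym2 V) // p.2 ⊆ Inc G p.1})
    (hxp : ∀ v, (x v).1 = Sum.inl (p v)) (hp : ∀ v, (p v).1.1 = v) :
    ∃ q : V → {p : V × Set (Sym2 V) // p.2 ⊆ Inc G p.1},
      (∀ v, (φ (x v)).1 = Sum.inl (q v)) ∧ ∀ v, (q v).1.1 = v := by
  have hle (v w : V) : CFIPre G (x v).1 (x w).1 ↔ v ≤ w := by
    rw [hxp, hxp]
    change (p v).1.1 ≤ (p w).1.1 ↔ _
    rw [hp, hp]
  have hleft (v : V) : ∃ q, (φ (x v)).1 = Sum.inl q := by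
    have h := (hφ.2 _ _).1 ((hle v v).2 le_rfl)
    rcases hy : (φ (x v)).1 with q | q
    · exact ⟨q, rfl⟩
    · rw [hy] at h
      exact h.elim
  choose q hq using hleft
  refine ⟨q, hq, fun v => ?_⟩
  have hmono : ∀ v w, (q v).1.1 ≤ (q w).1.1 ↔ v ≤ w := by
    intro v w
    rw [← hle v w, hφ.2, hq, hq]
    rfl
  have hstrict : StrictMono fun v => (q v).1.1 := fun v w h =>
    lt_of_not_ge fun h' => h.not_ge ((hmono _ _).1 h')
  exact le_antisymm hstrict.apply_le hstrict.le_apply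

lemma exists_incMatrix_mulVec_of_cfiSubIso {V : Type} [Fintype V] [LinearOrder V]
    (G : SimpleGraph V)
    [DecidableRel G.Adj] (hG : ∀ v, ∃ w, G.Adj v w) {T T' : Set V}
    {φ : ↥(CFISub G T) ≃ ↥(CFISub G T')} (hφ : CFISubIso G T T' φ) :
    ∃ d, (G.incMatrix (ZMod 2)).mulVec d = T.indicator 1 + T'.indicator 1 := by
  choose w hw using hG
  choose X hX hXT using fun v => exists_subset_inc_parity G (hw v) T
  let p (v : V) : {p : V × Set (Sym2 V) // p.2 ⊆ Inc G p.1} := ⟨(v, X v), hX v⟩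
  let x (v : V) : ↥(CFISub G T) := ⟨Sum.inl (p v), hXT v⟩
  obtain ⟨q, hq, hqv⟩ := exists_apply_eq_of_cfiSubIso G hφ x p (fun _ => rfl) (fun _ => rfl)
  let c (v : V) : Sym2 V → ZMod 2 := (X v).indicator 1 + (q v).1.2.indicator 1
  have hadj (u v : V) (h : G.Adj u v) : c u s(u, v) = c v s(u, v) := by
    have h1 := exists_common_neighbour_iff G T (p u) (p v) h
    have h2 := exists_common_neighbour_iff G T' (q u) (q v) (by rwa [hqv, hqv])
    rw [hqv, hqv, ← hq, ← hq] at h2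
    rw [φ.surjective.exists] at h2
    simp only [← hφ.1] at h2
    have h3 := h1.symm.trans h2
    by_cases a1 : s(u, v) ∈ X u <;> by_cases a2 : s(u, v) ∈ X v <;>
      by_cases a3 : s(u, v) ∈ (q u).1.2 <;> by_cases a4 : s(u, v) ∈ (q v).1.2 <;>
      simp [p, c, a1, a2, a3, a4] at h3 ⊢ <;> decide
  have hc (v : V) : (G.incMatrix (ZMod 2)).mulVec (c v) v =
      (T.indicator 1 + T'.indicator 1 : V → ZMod 2) v := by
    have hq' : Sum.inl (q v) ∈ CFISub G T' := hq v ▸ (φ (x v)).2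
    have h1 := (mem_iff_odd_card_iff G (hX v) T).1 (hXT v)
    have h2 := (mem_iff_odd_card_iff G (q v).2 T').1 hq'
    rw [hqv] at h2
    rw [Matrix.mulVec_add, Pi.add_apply, Pi.add_apply]
    convert congrArg₂ (· + ·) h1 h2
  refine ⟨fun e => c (Quot.out e).1 e, funext fun v => ?_⟩
  rw [← hc v]
  refine Finset.sum_congr rfl fun e _ => ?_
  by_cases he : e ∈ G.incidenceSet v
  · congr 1
    dsimp only
    have hm : (Quot.out e).1 ∈ e := Sym2.out_fst_mem e
    by_cases hv : v = (Quot.out e).1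
    · rw [← hv]
    · have hev : e = s(v, (Quot.out e).1) := (Sym2.mem_and_mem_iff hv).1 ⟨he.2, hm⟩
      generalize (Quot.out e).1 = u at *
      subst hev
      exact (hadj v u he.1).symm
  · simp [SimpleGraph.incMatrix_apply', he]

lemma eq_of_cfiSub_equiv_of_subsingleton {V : Type} [Subsingleton V] (G : SimpleGraph V)
    {T T' : Set V} (φ : ↥(CFISub G T) ≃ ↥(CFISub G T')) : T = T' := by
  have hnone (e : Sym2 V) : e ∉ G.edgeSet := by
    induction e with
    | _ a b => exact fun h => G.ne_of_adj h (Subsingleton.elim a b)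
  have key (S : Set V) (v : V) : v ∉ S ↔ Nonempty ↥(CFISub G S) := by
    constructor
    · intro hv
      refine ⟨⟨Sum.inl ⟨(v, ∅), Set.empty_subset _⟩, ?_⟩⟩
      change v ∈ S ↔ Odd (Nat.card (∅ : Set (Sym2 V)))
      simp [hv]
    · rintro ⟨⟨⟨⟨u, X⟩, hX⟩ | ⟨e, b⟩, hx⟩⟩ hv
      · have hX0 : X = ∅ := Set.eq_empty_of_forall_notMem fun e he => hnone e (hX he).1
        obtain rfl := Subsingleton.elim u v
        have hodd : Odd (Nat.card X) := hx.1 hv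
        simp [hX0] at hodd
      · exact hnone e.1 e.2
  ext v
  exact not_iff_not.1 ((key T v).trans (φ.nonempty_congr.trans (key T' v).symm))

lemma card_mod_two_eq_iff {V : Type} [Fintype V] (T T' : Set V) :
    Nat.card T % 2 = Nat.card T' % 2 ↔
      ∑ v, (T.indicator 1 + T'.indicator 1 : V → ZMod 2) v = 0 := by
  simp only [Pi.add_apply, Finset.sum_add_distrib, sum_indicator_one_eq_card]
  rw [CharTwo.add_eq_zero, ZMod.natCast_eq_natCast_iff']

/-- For a finite connected graph `G` (with linearly ordered vertices), the structures
`𝔊^T` and `𝔊^{T'}` are isomorphic iff `|T| ≡ |T'| (mod 2)`. -/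
theorem stmt7 {V : Type} [Fintype V] [LinearOrder V] (G : SimpleGraph V)
    (hG : G.Connected) (T T' : Set V) :
    (∃ φ : ↥(CFISub G T) ≃ ↥(CFISub G T'), CFISubIso G T T' φ) ↔
    Nat.card T % 2 = Nat.card T' % 2 := by
  classical
  constructor
  · rintro ⟨φ, hφ⟩
    rcases subsingleton_or_nontrivial V with _ | _
    · rw [eq_of_cfiSub_equiv_of_subsingleton G φ]
    · rw [card_mod_two_eq_iff, ← exists_incMatrix_mulVec_eq_iff G hG]
      exact exists_incMatrix_mulVec_of_cfiSubIso G hG.preconnected.exists_adj_of_nontrivial hφ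
  · intro h
    rw [card_mod_two_eq_iff, ← exists_incMatrix_mulVec_eq_iff G hG] at h
    obtain ⟨d, hd⟩ := h
    exact ⟨(cfiFlip_involutive G {e | d e ≠ 0}).toPerm.subtypeEquiv (cfiFlip_mem_iff G T T' hd),
      fun x y => (cfiAdj_flip_iff G _ x.1 y.1).symm,
      fun x y => (cfiPre_flip_iff G _ x.1 y.1).symm⟩
end

section
/- Let M be a 3-multipede with segment set Seg, foot set Feet, foot-to-segment map S, hyperedge family H, and positive-triple family P. Then the automorphisms of M are exactly the pairs (f, id_Seg) where, for some set X ⊆ Seg satisfying |X ∩ h| even for every h ∈ H, the map f interchanges the two feet of each segment in X and fixes every other foot; moreover X ↦ (f_X, id_Seg) is a group isomorphism from the group ({X ⊆ Seg : ∀ h ∈ H, |X ∩ h| is even}, △) (symmetric difference) onto the automorphism group of M. -/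
/-- `X` is a set of segments whose intersection with every hyperedge is even. -/
def GoodX {Seg : Type} [DecidableEq Seg] (H : Set (Finset Seg)) (X : Finset Seg) : Prop :=
  ∀ h ∈ H, (h ∩ X).card % 2 = 0

/-- `f` interchanges the two feet of each segment in `X` and fixes all other feet. -/
def SwapAt {Feet Seg : Type} (S : Feet → Seg) (X : Finset Seg) (f : Feet → Feet) : Prop :=
  Function.Bijective f ∧ (∀ x : Feet, S (f x) = S x) ∧ (∀ x : Feet, f x ≠ x ↔ S x ∈ X)

/-- `(f, g)` is an automorphism of the 3-multipede with data `S`, `H`, `P`, `≤`. -/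
def IsAutMP {Feet Seg : Type} [DecidableEq Feet] [DecidableEq Seg] [LE Seg]
    (S : Feet → Seg) (H : Set (Finset Seg)) (P : Set (Finset Feet))
    (f : Feet → Feet) (g : Seg → Seg) : Prop :=
  Function.Bijective f ∧ Function.Bijective g ∧
  (∀ x : Feet, S (f x) = g (S x)) ∧
  (∀ h : Finset Seg, h ∈ H ↔ h.image g ∈ H) ∧
  (∀ p : Finset Feet, p ∈ P ↔ p.image f ∈ P) ∧
  (∀ s s' : Seg, s ≤ s' ↔ g s ≤ g s')

theorem card_filter_xor_mod_two {α : Type*} (q : Finset α) (A B C : α → Prop)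
    [DecidablePred A] [DecidablePred B] [DecidablePred C]
    (hABC : ∀ x ∈ q, A x ↔ Xor (B x) (C x)) :
    (q.filter A).card % 2 = ((q.filter B).card + (q.filter C).card) % 2 := by
  classical
  induction q using Finset.induction_on with
  | empty => simp
  | insert a s ha ih =>
    have ih := ih fun x hx => hABC x (Finset.mem_insert_of_mem hx)
    have h := hABC a (Finset.mem_insert_self a s)
    by_cases hB : B a <;> by_cases hC : C a <;> simp [Xor, hB, hC] at h <;>
      simp [Finset.filter_insert, h, hB, hC, ha] <;> omega

theorem card_inter_symmDiff_mod_two {α : Type*} [DecidableEq α] (h X Y : Finset α) :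
    (h ∩ symmDiff X Y).card % 2 = ((h ∩ X).card + (h ∩ Y).card) % 2 := by
  simp only [← Finset.filter_mem_eq_inter]
  exact card_filter_xor_mod_two h _ _ _ fun x _ => Finset.mem_symmDiff

/-- For finite sets of size three, the symmetric difference has size divisible by four
exactly when the intersection has odd size. -/
theorem card_symmDiff_mod_four_iff {α : Type*} [DecidableEq α] {q r : Finset α}
    (hq : q.card = 3) (hr : r.card = 3) :
    (symmDiff q r).card % 4 = 0 ↔ (q ∩ r).card % 2 = 1 := by
  have h : (symmDiff q r).card = (q \ r).card + (r \ q).card :=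
    Finset.card_union_of_disjoint disjoint_sdiff_sdiff
  have h₁ := Finset.card_sdiff_add_card_inter q r
  have h₂ := Finset.card_sdiff_add_card_inter r q
  rw [Finset.inter_comm r q] at h₂
  omega

/-- A map with two-element fibres admits a fibrewise transposition. -/
theorem exists_other_foot {Feet Seg : Type} (S : Feet → Seg)
    (htwo : ∀ s : Seg, Nat.card {x : Feet // S x = s} = 2) :
    ∃ τ : Feet → Feet, (∀ x, S (τ x) = S x) ∧ (∀ x, τ x ≠ x) ∧
      ∀ x y, S y = S x → y = x ∨ y = τ x := by
  have key : ∀ x, ∃ z, S z = S x ∧ z ≠ x ∧ ∀ y, S y = S x → y = x ∨ y = z := by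
    intro x
    obtain ⟨⟨z, hz⟩, hne, huniv⟩ :=
      (Nat.card_eq_two_iff' (⟨x, rfl⟩ : {y : Feet // S y = S x})).1 (htwo (S x))
    refine ⟨z, hz, fun h => hne (Subtype.ext h), fun y hy => ?_⟩
    by_contra! hcon
    exact hcon.2 (congrArg Subtype.val
      (huniv ⟨y, hy⟩ fun h => hcon.1 (congrArg Subtype.val h)))
  choose τ h₁ h₂ h₃ using key
  exact ⟨τ, h₁, h₂, h₃⟩

section OtherFoot

variable {Feet Seg : Type} {S : Feet → Seg} {τ : Feet → Feet}

theorem other_foot_involutive (hτS : ∀ x, S (τ x) = S x) (hτne : ∀ x, τ x ≠ x)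
    (hτ : ∀ x y, S y = S x → y = x ∨ y = τ x) (x : Feet) : τ (τ x) = x :=
  ((hτ x (τ (τ x)) ((hτS _).trans (hτS x))).resolve_right (hτne _))

theorem swapAt_iff [DecidableEq Seg] (hτS : ∀ x, S (τ x) = S x) (hτne : ∀ x, τ x ≠ x)
    (hτ : ∀ x y, S y = S x → y = x ∨ y = τ x) (X : Finset Seg) (f : Feet → Feet) :
    SwapAt S X f ↔ ∀ x, f x = if S x ∈ X then τ x else x := by
  constructor
  · rintro ⟨-, hS, hX⟩ x
    split_ifs with h
    · exact (hτ x (f x) (hS x)).resolve_left ((hX x).2 h)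
    · exact not_not.1 fun hne => h ((hX x).1 hne)
  · intro hf
    have hS : ∀ x, S (f x) = S x := fun x => by
      rw [hf]; split_ifs <;> simp [hτS]
    refine ⟨Function.Involutive.bijective fun x => ?_, hS, fun x => ?_⟩
    · rw [hf (f x), hS, hf x]
      split_ifs <;> simp [other_foot_involutive hτS hτne hτ]
    · rw [hf]; split_ifs with h <;> simp [h, hτne]

theorem SwapAt.mem_iff [DecidableEq Feet] [DecidableEq Seg] (hτS : ∀ x, S (τ x) = S x)
    (hτne : ∀ x, τ x ≠ x) (hτ : ∀ x y, S y = S x → y = x ∨ y = τ x)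
    {X : Finset Seg} {f : Feet → Feet} (hf : SwapAt S X f) {r : Finset Feet}
    (hr : Set.InjOn S r) {x : Feet} (hx : S x ∈ r.image S) :
    f x ∈ r ↔ Xor (x ∈ r) (S x ∈ X) := by
  rw [(swapAt_iff hτS hτne hτ X f).1 hf x]
  obtain ⟨y, hy, hyx⟩ := Finset.mem_image.1 hx
  have hor : x ∈ r ∨ τ x ∈ r := by
    rcases hτ x y hyx with rfl | rfl
    · exact Or.inl hy
    · exact Or.inr hy
  have hnot : ¬ (x ∈ r ∧ τ x ∈ r) := fun h => hτne x (hr h.2 h.1 (hτS x))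
  unfold Xor
  split_ifs with h <;> tauto

/-- Applying a swap at `X` to a transversal of `h` changes the number of feet it shares with
another transversal of `h` by `|h ∩ X|` modulo two. -/
theorem SwapAt.card_image_inter [DecidableEq Feet] [DecidableEq Seg] (hτS : ∀ x, S (τ x) = S x)
    (hτne : ∀ x, τ x ≠ x) (hτ : ∀ x y, S y = S x → y = x ∨ y = τ x)
    {X : Finset Seg} {f : Feet → Feet} (hf : SwapAt S X f) {q r : Finset Feet}
    (hq : Set.InjOn S q) (hr : Set.InjOn S r) (hqr : q.image S = r.image S) :
    (q.image f ∩ r).card % 2 = ((q ∩ r).card + (q.image S ∩ X).card) % 2 := by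
  have h₁ : (q.image f ∩ r).card = (q.filter fun x => f x ∈ r).card := by
    rw [← Finset.filter_mem_eq_inter, Finset.filter_image,
      Finset.card_image_of_injective _ hf.1.1]
  have h₂ : (q.image S ∩ X).card = (q.filter fun x => S x ∈ X).card := by
    rw [← Finset.filter_mem_eq_inter, Finset.filter_image, Finset.card_image_of_injOn]
    exact hq.mono fun x hx => (Finset.mem_filter.1 hx).1
  rw [h₁, h₂, ← Finset.filter_mem_eq_inter]
  exact card_filter_xor_mod_two q _ _ _ fun x hx =>
    hf.mem_iff hτS hτne hτ hr (hqr ▸ Finset.mem_image_of_mem S hx)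

theorem SwapAt.image_image [DecidableEq Feet] [DecidableEq Seg] {X : Finset Seg} {f : Feet → Feet}
    (hf : SwapAt S X f) (q : Finset Feet) : (q.image f).image S = q.image S := by
  rw [Finset.image_image]
  exact Finset.image_congr fun x _ => hf.2.1 x

end OtherFoot

/-- The automorphisms of a 3-multipede are exactly the pairs `(f_X, id)` where `X` is a
set of segments meeting every hyperedge evenly and `f_X` interchanges the two feet of
each segment in `X`, fixing all other feet; moreover `X ↦ (f_X, id)` is a group
isomorphism from the group of such `X` under symmetric difference onto the automorphism
group: each `X` determines a unique `f_X`, each `(f_X, id)` is an automorphism, every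
automorphism arises from a unique such `X`, and the map takes symmetric differences to
compositions. -/
theorem stmt8 {Feet Seg : Type} [Fintype Feet] [Fintype Seg]
    [DecidableEq Feet] [DecidableEq Seg] [LinearOrder Seg]
    (S : Feet → Seg) (H : Set (Finset Seg)) (P : Set (Finset Feet))
    (htwo : ∀ s : Seg, Nat.card {x : Feet // S x = s} = 2)
    (hH3 : ∀ h ∈ H, h.card = 3)
    (hP3 : ∀ p ∈ P, p.card = 3)
    (hPH : ∀ p ∈ P, (p.image S).card = 3 ∧ p.image S ∈ H)
    (hclass : ∀ h ∈ H, ∃ q₀ : Finset Feet, q₀.image S = h ∧ q₀.card = 3 ∧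
      ∀ q : Finset Feet, q.image S = h → q.card = 3 →
        (q ∈ P ↔ (symmDiff q q₀).card % 4 = 0)) :
    -- each good `X` determines a unique foot-swapping map `f_X`
    (∀ X : Finset Seg, GoodX H X → ∃! f : Feet → Feet, SwapAt S X f) ∧
    -- each pair `(f_X, id)` is an automorphism
    (∀ (X : Finset Seg) (f : Feet → Feet), GoodX H X → SwapAt S X f →
      IsAutMP S H P f id) ∧
    -- every automorphism is of this form, for a unique good `X`
    (∀ (f : Feet → Feet) (g : Seg → Seg), IsAutMP S H P f g →
      (∀ s : Seg, g s = s) ∧ ∃! X : Finset Seg, GoodX H X ∧ SwapAt S X f) ∧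
    -- the map `X ↦ f_X` is a homomorphism for symmetric difference and composition
    (∀ (X X' : Finset Seg) (f f' : Feet → Feet), GoodX H X → GoodX H X' →
      SwapAt S X f → SwapAt S X' f' →
      GoodX H (symmDiff X X') ∧ SwapAt S (symmDiff X X') (f ∘ f')) := by
  obtain ⟨τ, hτS, hτne, hτ⟩ := exists_other_foot S htwo
  have hinj : ∀ q : Finset Feet, q.card = 3 → (q.image S).card = 3 → Set.InjOn S q :=
    fun q h₁ h₂ => Finset.card_image_iff.1 (h₂.trans h₁.symm)
  refine ⟨fun X _ => ?_, fun X f hX hf => ?_, fun f g hfg => ?_,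
    fun X X' f f' hX hX' hf hf' => ⟨fun h hh => ?_, ?_⟩⟩
  · refine ⟨fun x => if S x ∈ X then τ x else x,
      (swapAt_iff hτS hτne hτ X _).2 fun _ => rfl, fun f hf => ?_⟩
    exact funext ((swapAt_iff hτS hτne hτ X f).1 hf)
  · have hcard : ∀ p : Finset Feet, (p.image f).card = p.card :=
      fun p => Finset.card_image_of_injective p hf.1.1
    have key : ∀ p : Finset Feet, p.card = 3 → p.image S ∈ H →
        (p ∈ P ↔ p.image f ∈ P) := by
      intro p hp hpH
      obtain ⟨q₀, hq₀S, hq₀, hq₀P⟩ := hclass _ hpH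
      have hp' := (hcard p).trans hp
      rw [hq₀P p rfl hp, hq₀P _ (hf.image_image p) hp', card_symmDiff_mod_four_iff hp hq₀,
        card_symmDiff_mod_four_iff hp' hq₀]
      have h₁ := hf.card_image_inter hτS hτne hτ (hinj p hp (hH3 _ hpH))
        (hinj q₀ hq₀ (hq₀S ▸ hH3 _ hpH)) hq₀S.symm
      have h₂ := hX _ hpH
      omega
    refine ⟨hf.1, Function.bijective_id, hf.2.1, by simp, fun p => ⟨fun hp => ?_, fun hp => ?_⟩,
      fun _ _ => Iff.rfl⟩
    · exact (key p (hP3 p hp) (hPH p hp).2).1 hp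
    · exact (key p ((hcard p).symm.trans (hP3 _ hp))
        (hf.image_image p ▸ (hPH _ hp).2)).2 hp
  · obtain ⟨hfb, hgb, hS, -, hP, hle⟩ := hfg
    have hg : StrictMono g := fun a b hab => by
      rw [lt_iff_le_not_ge] at hab ⊢
      rwa [← hle, ← hle]
    have hid : ∀ s, g s = s := fun s => le_antisymm hg.apply_le hg.le_apply
    have hfS : ∀ x, S (f x) = S x := fun x => (hS x).trans (hid _)
    have hsurj : ∀ s, ∃ x, S x = s := fun s => by
      have : Nonempty {x : Feet // S x = s} := (Nat.card_pos_iff.1 (by rw [htwo]; simp)).1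
      exact this.elim fun x => ⟨x.1, x.2⟩
    have hswap : SwapAt S (Finset.univ.filter fun s => ∃ x, S x = s ∧ f x ≠ x) f := by
      refine ⟨hfb, hfS, fun x => ?_⟩
      simp only [Finset.mem_filter, Finset.mem_univ, true_and]
      refine ⟨fun h => ⟨x, rfl, h⟩, ?_⟩
      rintro ⟨y, hyx, hy⟩ hx
      rcases hτ y x hyx.symm with rfl | rfl
      · exact hy hx
      · exact hτne y (hfb.1 (hx.trans ((hτ y (f y) (hfS y)).resolve_left hy).symm))
    refine ⟨hid, _, ⟨fun h hh => ?_, hswap⟩, ?_⟩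
    · obtain ⟨q₀, hq₀S, hq₀, hq₀P⟩ := hclass h hh
      have hq₀' := (Finset.card_image_of_injective q₀ hfb.1).trans hq₀
      have hmem : q₀ ∈ P := (hq₀P q₀ hq₀S hq₀).2 (by simp)
      have hmem' := (hq₀P _ ((hswap.image_image q₀).trans hq₀S) hq₀').1 ((hP q₀).1 hmem)
      rw [card_symmDiff_mod_four_iff hq₀' hq₀] at hmem'
      have hinj₀ := hinj q₀ hq₀ (hq₀S ▸ hH3 h hh)
      have hpar := hswap.card_image_inter hτS hτne hτ hinj₀ hinj₀ rfl
      rw [Finset.inter_self, hq₀S] at hpar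
      omega
    · rintro Y ⟨-, hY⟩
      ext s
      obtain ⟨x, rfl⟩ := hsurj s
      exact (hY.2.2 x).symm.trans (hswap.2.2 x)
  · have h₁ := hX h hh
    have h₂ := hX' h hh
    have h₃ := card_inter_symmDiff_mod_two h X X'
    omega
  · refine (swapAt_iff hτS hτne hτ _ _).2 fun x => ?_
    rw [Function.comp_apply, (swapAt_iff hτS hτne hτ X f).1 hf, hf'.2.1,
      (swapAt_iff hτS hτne hτ X' f').1 hf' x]
    by_cases h₁ : S x ∈ X <;> by_cases h₂ : S x ∈ X' <;>
      simp [Finset.mem_symmDiff, h₁, h₂, other_foot_involutive hτS hτne hτ]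
end

section
/- Every odd 3-multipede is rigid: if M is a 3-multipede such that for every nonempty set X ⊆ Seg of segments there is a hyperedge h ∈ H with |h ∩ X| odd, then the only automorphism of M is the identity (on both feet and segments). -/
/-- Every odd 3-multipede is rigid: any automorphism `(f, g)` of a 3-multipede in which
every nonempty set of segments meets some hyperedge oddly is the identity. -/
theorem stmt9 {Feet Seg : Type} [Fintype Feet] [Fintype Seg]
    [DecidableEq Feet] [DecidableEq Seg] [LinearOrder Seg]
    (S : Feet → Seg) (H : Set (Finset Seg)) (P : Set (Finset Feet))
    -- every segment is the image of exactly two feet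
    (htwo : ∀ s : Seg, Nat.card {x : Feet // S x = s} = 2)
    -- hyperedges are 3-element sets of segments, positive triples are 3-element sets of feet
    (hH3 : ∀ h ∈ H, h.card = 3)
    (hP3 : ∀ p ∈ P, p.card = 3)
    -- (i) `S` is injective on each positive triple and maps it onto a hyperedge
    (hPH : ∀ p ∈ P, (p.image S).card = 3 ∧ p.image S ∈ H)
    -- (ii) for each hyperedge the positive triples among its eight lifts form exactly one
    -- of the two classes of four under "differing at an even number of segments"
    (hclass : ∀ h ∈ H, ∃ q₀ : Finset Feet, q₀.image S = h ∧ q₀.card = 3 ∧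
      ∀ q : Finset Feet, q.image S = h → q.card = 3 →
        (q ∈ P ↔ (symmDiff q q₀).card % 4 = 0))
    -- oddness
    (hodd : ∀ X : Finset Seg, X.Nonempty → ∃ h ∈ H, (h ∩ X).card % 2 = 1)
    -- an automorphism `(f, g)`
    (f : Feet ≃ Feet) (g : Seg ≃ Seg)
    (hfg : ∀ x : Feet, S (f x) = g (S x))
    (hgH : ∀ h : Finset Seg, h ∈ H ↔ h.image g ∈ H)
    (hfP : ∀ p : Finset Feet, p ∈ P ↔ p.image f ∈ P)
    (hgle : ∀ s s' : Seg, s ≤ s' ↔ g s ≤ g s') :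
    (∀ x : Feet, f x = x) ∧ (∀ s : Seg, g s = s) := by
  have hg : ∀ s, g s = s := fun s =>
    DFunLike.congr_fun
      (Subsingleton.elim (⟨g, fun {a b} => (hgle a b).symm⟩ : Seg ≃o Seg) (OrderIso.refl Seg)) s
  have hS : ∀ x, S (f x) = S x := fun x => (hfg x).trans (hg _)
  refine ⟨?_, hg⟩
  by_contra! hne
  obtain ⟨x₀, hx₀⟩ := hne
  have hfix : ∀ x y, S y = S x → f y ≠ y → f x ≠ x := by
    intro x y hxy hy hx
    obtain ⟨⟨a, ha⟩, ⟨b, hb⟩, -, huniv⟩ := Nat.card_eq_two_iff.1 (htwo (S x))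
    have hmem : ∀ z, S z = S x → z = a ∨ z = b := by
      intro z hz
      have : (⟨z, hz⟩ : {z : Feet // S z = S x}) ∈
          ({⟨a, ha⟩, ⟨b, hb⟩} : Set {z : Feet // S z = S x}) := huniv ▸ Set.mem_univ _
      simpa using this
    have hyx : y ≠ x := fun e => hy (e ▸ hx)
    have hfyx : f y ≠ x := fun e => hyx (f.injective (e.trans hx.symm))
    have h₁ := hmem x rfl
    have h₂ := hmem y hxy
    have h₃ := hmem (f y) ((hS y).trans hxy)
    grind
  obtain ⟨h, hh, hodd'⟩ := hodd ((Finset.univ.filter fun x => f x ≠ x).image S)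
    ⟨S x₀, Finset.mem_image_of_mem _ (by simpa using hx₀)⟩
  obtain ⟨q₀, hq₀, hcard, hq⟩ := hclass h hh
  have hinj : Set.InjOn S q₀ := Finset.card_image_iff.1 (by rw [hq₀, hH3 h hh, hcard])
  have hq₀P : q₀ ∈ P := (hq q₀ hq₀ hcard).2 (by simp)
  have hcard' : (q₀.image f).card = q₀.card := Finset.card_image_of_injective _ f.injective
  have hmod := (hq (q₀.image f)
    (by rw [Finset.image_image, ← hq₀]; exact Finset.image_congr fun x _ => hS x)
    (hcard'.trans hcard)).1 ((hfP q₀).1 hq₀P)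
  have hmoved : q₀ \ q₀.image f = q₀.filter fun x => f x ≠ x := by
    ext x
    simp only [Finset.mem_sdiff, Finset.mem_filter, Finset.mem_image, not_exists, not_and]
    refine and_congr_right fun hx => ⟨fun H' => H' x hx, fun hfx y hy e => hfx ?_⟩
    have hyx : y = x := hinj hy hx (by rw [← hS y, e])
    rwa [hyx] at e
  have hinter : h ∩ (Finset.univ.filter fun x => f x ≠ x).image S =
      (q₀.filter fun x => f x ≠ x).image S := by
    ext s
    simp only [← hq₀, Finset.mem_inter, Finset.mem_image, Finset.mem_filter, Finset.mem_univ,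
      true_and]
    constructor
    · rintro ⟨⟨x, hx, rfl⟩, y, hy, hyx⟩
      exact ⟨x, ⟨hx, hfix x y hyx hy⟩, rfl⟩
    · rintro ⟨x, ⟨hx, hfx⟩, rfl⟩
      exact ⟨⟨x, hx, rfl⟩, x, hfx, rfl⟩
  have hsymm : (symmDiff (q₀.image f) q₀).card =
      (q₀.image f \ q₀).card + (q₀ \ q₀.image f).card :=
    Finset.card_union_of_disjoint disjoint_sdiff_sdiff
  have hsdiff := Finset.card_sdiff_comm hcard'
  rw [hinter, Finset.card_image_of_injOn (hinj.mono (Finset.filter_subset _ _)), ← hmoved]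
    at hodd'
  omega
end

section
/- Every odd 4-multipede is rigid: if M is a 4-multipede such that for every nonempty set X ⊆ Seg of segments there is a hyperedge h ∈ H with |h ∩ X| odd, then the only automorphism of M is the identity (on feet, segments, and sets). -/
/-- A finite linear order has no nontrivial order-preserving permutation. -/
theorem equiv_eq_self_of_le_iff_le {α : Type*} [Fintype α] [LinearOrder α] (g : α ≃ α)
    (hg : ∀ a b : α, a ≤ b ↔ g a ≤ g b) (a : α) : g a = a := by
  let e : α ≃o α := ⟨g, fun {a b} => (hg a b).symm⟩
  exact DFunLike.congr_fun (Subsingleton.elim e (OrderIso.refl α)) a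

/-- An injective self-map of a two-element fibre moving one of its points moves both. -/
theorem ne_of_ne_of_card_fiber_eq_two {α β : Type*} [Fintype α] (S : α → β)
    (f : α ≃ α) (hf : ∀ x, S (f x) = S x) {x y : α} (hxy : S y = S x)
    (hcard : Nat.card {z : α // S z = S x} = 2) (hy : f y ≠ y) : f x ≠ x := by
  classical
  intro hx
  have hne : y ≠ x := by rintro rfl; exact hy hx
  have hfy : f y ≠ x := fun h => hne (f.injective (h.trans hx.symm))
  have hsub : ({x, y, f y} : Finset α) ⊆ Finset.univ.filter (fun z => S z = S x) := by
    intro z hz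
    simp only [Finset.mem_insert, Finset.mem_singleton] at hz
    rcases hz with rfl | rfl | rfl <;> simp [hf, hxy]
  have hle := Finset.card_le_card hsub
  rw [Finset.card_eq_three.mpr ⟨x, y, f y, hne.symm, hfy.symm, hy.symm, rfl⟩,
    ← Fintype.card_subtype, ← Nat.card_eq_fintype_card, hcard] at hle
  omega

/-- If `S` is injective on `q` and `f` preserves the fibres of `S`, then `q` and its image under
`f` differ in twice as many points as `f` moves in `q`. -/
theorem card_symmDiff_image_of_injOn {α β : Type*} [DecidableEq α] (S : α → β)
    (f : α ≃ α) (hf : ∀ x, S (f x) = S x) (q : Finset α) (hq : Set.InjOn S q) :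
    (symmDiff (q.image f) q).card = 2 * (q.filter (fun x => f x ≠ x)).card := by
  have hfix : ∀ x ∈ q, f x ∈ q → f x = x := fun x hx hfx => hq hfx hx (hf x)
  have h₁ : q.image f \ q = (q.filter (fun x => f x ≠ x)).image f := by
    ext z
    simp only [Finset.mem_sdiff, Finset.mem_image, Finset.mem_filter]
    constructor
    · rintro ⟨⟨x, hx, rfl⟩, hz⟩
      exact ⟨x, ⟨hx, fun h => hz (h.symm ▸ hx)⟩, rfl⟩
    · rintro ⟨x, ⟨hx, hne⟩, rfl⟩
      exact ⟨⟨x, hx, rfl⟩, fun h => hne (hfix x hx h)⟩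
  have h₂ : q \ q.image f = q.filter (fun x => f x ≠ x) := by
    ext z
    simp only [Finset.mem_sdiff, Finset.mem_image, Finset.mem_filter]
    refine and_congr_right fun hz => ⟨fun h hfz => h ⟨z, hz, hfz⟩, ?_⟩
    rintro hne ⟨x, hx, rfl⟩
    exact hne (congrArg f (hfix x hx hz))
  rw [symmDiff_def, Finset.sup_eq_union, Finset.card_union_of_disjoint disjoint_sdiff_sdiff,
    h₁, h₂, Finset.card_image_of_injective _ f.injective]
  omega


/-- Every odd 4-multipede is rigid: any automorphism `(f, g, k)` of a 4-multipede in
which every nonempty set of segments meets some hyperedge oddly is the identity on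
feet, segments, and sets. -/
theorem stmt10 {Feet Seg Sets : Type} [Fintype Feet] [Fintype Seg] [Fintype Sets]
    [DecidableEq Feet] [DecidableEq Seg] [LinearOrder Seg]
    (S : Feet → Seg) (H : Set (Finset Seg)) (P : Set (Finset Feet))
    (eps : Seg → Sets → Prop)
    -- every segment is the image of exactly two feet
    (htwo : ∀ s : Seg, Nat.card {x : Feet // S x = s} = 2)
    -- hyperedges are 3-element sets of segments, positive triples are 3-element sets of feet
    (hH3 : ∀ h ∈ H, h.card = 3)
    (hP3 : ∀ p ∈ P, p.card = 3)
    -- (i) `S` is injective on each positive triple and maps it onto a hyperedge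
    (hPH : ∀ p ∈ P, (p.image S).card = 3 ∧ p.image S ∈ H)
    -- (ii) for each hyperedge the positive triples among its eight lifts form exactly one
    -- of the two classes of four under "differing at an even number of segments"
    (hclass : ∀ h ∈ H, ∃ q₀ : Finset Feet, q₀.image S = h ∧ q₀.card = 3 ∧
      ∀ q : Finset Feet, q.image S = h → q.card = 3 →
        (q ∈ P ↔ (symmDiff q q₀).card % 4 = 0))
    -- `Sets` together with `eps` represents exactly the power set of `Seg`
    (heps : ∀ A : Set Seg, ∃! x : Sets, ∀ s : Seg, eps s x ↔ s ∈ A)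
    -- oddness
    (hodd : ∀ X : Finset Seg, X.Nonempty → ∃ h ∈ H, (h ∩ X).card % 2 = 1)
    -- an automorphism `(f, g, k)`
    (f : Feet ≃ Feet) (g : Seg ≃ Seg) (k : Sets ≃ Sets)
    (hfg : ∀ x : Feet, S (f x) = g (S x))
    (hgH : ∀ h : Finset Seg, h ∈ H ↔ h.image g ∈ H)
    (hfP : ∀ p : Finset Feet, p ∈ P ↔ p.image f ∈ P)
    (hgle : ∀ s s' : Seg, s ≤ s' ↔ g s ≤ g s')
    (hk : ∀ (s : Seg) (x : Sets), eps s x ↔ eps (g s) (k x)) :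
    (∀ x : Feet, f x = x) ∧ (∀ s : Seg, g s = s) ∧ (∀ x : Sets, k x = x) := by
  have hg : ∀ s, g s = s := equiv_eq_self_of_le_iff_le g hgle
  have hf : ∀ x, S (f x) = S x := fun x => (hfg x).trans (hg _)
  refine ⟨?_, hg, fun x => ?_⟩
  · by_contra! hmoved
    obtain ⟨y, hy⟩ := hmoved
    let M : Finset Feet := Finset.univ.filter (fun x => f x ≠ x)
    have hmem : ∀ x, S x ∈ M.image S ↔ f x ≠ x := by
      intro x
      refine ⟨fun hx => ?_, fun hx => Finset.mem_image_of_mem S (by simpa [M] using hx)⟩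
      obtain ⟨z, hz, hzx⟩ := Finset.mem_image.mp hx
      exact ne_of_ne_of_card_fiber_eq_two S f hf hzx (htwo _) (by simpa [M] using hz)
    obtain ⟨h, hh, hcard_odd⟩ := hodd (M.image S) ⟨S y, (hmem y).mpr hy⟩
    obtain ⟨q, hqh, hq3, hq⟩ := hclass h hh
    have hqP : q ∈ P := (hq q hqh hq3).mpr (by simp)
    have hinj : Set.InjOn S q := Finset.card_image_iff.mp (by rw [hqh, hH3 h hh, hq3])
    have hfqh : (q.image f).image S = h := by
      rw [Finset.image_image, ← hqh]
      exact Finset.image_congr fun x _ => hf x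
    have hmod := (hq (q.image f) hfqh
      (by rw [Finset.card_image_of_injective _ f.injective, hq3])).mp ((hfP q).mp hqP)
    rw [card_symmDiff_image_of_injOn S f hf q hinj] at hmod
    have hinter : h ∩ M.image S = (q.filter (fun x => f x ≠ x)).image S := by
      ext s
      simp only [Finset.mem_inter, ← hqh]
      constructor
      · rintro ⟨hs, hsM⟩
        obtain ⟨x, hx, rfl⟩ := Finset.mem_image.mp hs
        exact Finset.mem_image_of_mem S (Finset.mem_filter.mpr ⟨hx, (hmem x).mp hsM⟩)
      · intro hs
        obtain ⟨x, hx, rfl⟩ := Finset.mem_image.mp hs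
        obtain ⟨hxq, hne⟩ := Finset.mem_filter.mp hx
        exact ⟨Finset.mem_image_of_mem S hxq, (hmem x).mpr hne⟩
    rw [hinter, Finset.card_image_of_injOn
      (hinj.mono (Finset.coe_subset.mpr (Finset.filter_subset _ _)))] at hcard_odd
    omega
  · refine (heps {s | eps s x}).unique (fun s => ?_) fun s => Iff.rfl
    simpa [hg] using (hk s x).symm
end

section
/- Let n ≥ 1 be a natural number and let M be an n × n matrix over the integers ℤ such that |M i j| ≤ 2^n for all indices i, j. Then det M ≠ 0 if and only if there is a prime p among the smallest 2n² prime numbers (i.e., p is the k-th prime for some k < 2n²) such that p does not divide det M. -/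
/-- If each of the first `m` primes divides a nonzero natural number `N`, then `2 ^ m ≤ N`. -/
theorem two_pow_le_of_forall_nth_prime_dvd {m N : ℕ} (hN : N ≠ 0)
    (hdvd : ∀ k < m, Nat.nth Nat.Prime k ∣ N) : 2 ^ m ≤ N := by
  have hprod : ∏ k ∈ Finset.range m, Nat.nth Nat.Prime k ∣ N := by
    refine Finset.prod_dvd_of_isRelPrime (fun i _ j _ hij ↦ ?_)
      fun k hk ↦ hdvd k (Finset.mem_range.mp hk)
    exact Nat.coprime_iff_isRelPrime.mp <|
      (Nat.coprime_primes (Nat.prime_nth_prime i) (Nat.prime_nth_prime j)).mpr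
        ((Nat.nth_injective Nat.infinite_setOfPred_prime).ne hij)
  calc 2 ^ m = ∏ _k ∈ Finset.range m, 2 := by simp
    _ ≤ ∏ k ∈ Finset.range m, Nat.nth Nat.Prime k :=
      Finset.prod_le_prod' fun k _ ↦ (Nat.prime_nth_prime k).two_le
    _ ≤ N := Nat.le_of_dvd (Nat.pos_of_ne_zero hN) hprod

/-- An `n × n` integer matrix with entries at most `2 ^ n` in absolute value has determinant
less than `2 ^ (2 * n ^ 2)` in absolute value. -/
theorem Matrix.natAbs_det_lt_of_abs_le_two_pow {n : ℕ} (hn : 1 ≤ n)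
    (M : Matrix (Fin n) (Fin n) ℤ) (h : ∀ i j : Fin n, |M i j| ≤ 2 ^ n) :
    M.det.natAbs < 2 ^ (2 * n ^ 2) := by
  have hdet : |M.det| ≤ n.factorial • ((2 : ℤ) ^ n) ^ n := by
    simpa using Matrix.det_le (abv := AbsoluteValue.abs) h
  have hdet' : M.det.natAbs ≤ n.factorial * (2 ^ n) ^ n := by
    rw [nsmul_eq_mul, Int.abs_eq_natAbs] at hdet
    exact_mod_cast hdet
  calc M.det.natAbs ≤ n.factorial * (2 ^ n) ^ n := hdet'
    _ ≤ n ^ n * (2 ^ n) ^ n := by gcongr; exact Nat.factorial_le_pow n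
    _ < (2 ^ n) ^ n * (2 ^ n) ^ n := by
      gcongr
      exact Nat.lt_two_pow_self
    _ = 2 ^ (2 * n ^ 2) := by rw [← pow_mul, ← pow_add]; ring_nf

/-- Let `n ≥ 1` and let `M` be an `n × n` integer matrix with all entries at most `2^n`
in absolute value.  Then `det M ≠ 0` iff some prime among the smallest `2n²` primes
(the `k`-th primes for `k < 2n²`, where the 0-th prime is 2) does not divide `det M`. -/
theorem stmt14 (n : ℕ) (hn : 1 ≤ n) (M : Matrix (Fin n) (Fin n) ℤ)
    (h : ∀ i j : Fin n, |M i j| ≤ 2 ^ n) :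
    M.det ≠ 0 ↔ ∃ k : ℕ, k < 2 * n ^ 2 ∧ ¬ ((Nat.nth Nat.Prime k : ℤ) ∣ M.det) := by
  constructor
  · intro hdet
    by_contra! hdvd
    exact (M.natAbs_det_lt_of_abs_le_two_pow hn h).not_ge <|
      two_pow_le_of_forall_nth_prime_dvd (Int.natAbs_ne_zero.mpr hdet)
        fun k hk ↦ Int.natCast_dvd.mp (hdvd k hk)
  · rintro ⟨k, -, hk⟩ hdet
    exact hk (hdet ▸ dvd_zero _)
end
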